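/- Let Φ : 𝒜 → ℬ be a unital positive (not necessarily linear) map between unital C*-algebras with Φ(0) = 0 that enjoys property 𝒟_m for some m ≥ 3. Then for all self-adjoint A, B ∈ 𝒜: (i) the variance-covariance matrix [[Var_Φ(A), Cov_Φ(A,B)], [Cov_Φ(B,A), Var_Φ(B)]] is positive in M₂(ℬ), and (ii) the matrix [[Var_Φ(A), Φ((1/2)[A,B])], [Φ((1/2)[B,A]), Var_Φ(B)]] is positive in M₂(ℬ). -/

import Mathlib

/-- An element of a C*-algebra is positive if and only if it is of the form `star b * b`. -/
def IsPosElem {A : Type*} [Mul A] [Star A] (a : A) : Prop := ∃ b : A, a = star b * b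

/-- A (not necessarily linear) map `Φ : A → B` is `n`-positive if the entrywise induced map
on `n × n` matrices sends positive matrices to positive matrices. -/
def IsNPosMap {A B : Type*} [NonUnitalNonAssocSemiring A] [Star A]
    [NonUnitalNonAssocSemiring B] [Star B] (n : ℕ) (Φ : A → B) : Prop :=
  ∀ M : Matrix (Fin n) (Fin n) A, IsPosElem M → IsPosElem (M.map Φ)

universe v

/-- A unital positive map `Φ` enjoys property `𝒟_m` if it factors as `Φ = φ ∘ ψ` where
`ψ` is a unital positive linear map into some `C(Ω)` (`Ω` compact Hausdorff) and
`φ : C(Ω) → ℬ` is a unital `m`-positive map. -/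
def PropertyD {𝒜 ℬ : Type*} [CStarAlgebra 𝒜] [CStarAlgebra ℬ] (m : ℕ) (Φ : 𝒜 → ℬ) : Prop :=
  ∃ (Ω : Type v) (_ : TopologicalSpace Ω) (_ : CompactSpace Ω) (_ : T2Space Ω)
    (ψ : 𝒜 →ₗ[ℂ] C(Ω, ℂ)) (φ : C(Ω, ℂ) → ℬ),
    ψ 1 = 1 ∧ (∀ a : 𝒜, IsPosElem a → IsPosElem (ψ a)) ∧
    φ 1 = 1 ∧ IsNPosMap m φ ∧ ∀ a : 𝒜, Φ a = φ (ψ a)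

theorem isPosElem_add_gen {X : Type*} [CStarAlgebra X] (a b : X) (ha : IsPosElem a)
    (hb : IsPosElem b) : IsPosElem (a + b) := by
  let _ := CStarAlgebra.spectralOrder X
  let _ := CStarAlgebra.spectralOrderedRing X
  obtain ⟨x, rfl⟩ := ha
  obtain ⟨y, rfl⟩ := hb
  exact CStarAlgebra.nonneg_iff_eq_star_mul_self.mp
    (add_nonneg (star_mul_self_nonneg x) (star_mul_self_nonneg y))

theorem isPosElem_of_spectrum_gen {X : Type*} [CStarAlgebra X] (a : X) (ha : IsSelfAdjoint a)
    (h : ∀ r : ℝ, r < 0 → IsUnit (algebraMap ℂ X (r : ℂ) - a)) : IsPosElem a := by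
  let _ := CStarAlgebra.spectralOrder X
  let _ := CStarAlgebra.spectralOrderedRing X
  refine CStarAlgebra.nonneg_iff_eq_star_mul_self.mp ?_
  rw [StarOrderedRing.nonneg_iff_spectrum_nonneg (R := ℝ) _ ha]
  intro r hr
  by_contra hneg
  push Not at hneg
  exact hr (h r hneg)

open Matrix in
theorem isPosElem_add_aux {B : Type*} [CStarAlgebra B] {n : Type*} [Fintype n]
    (M N : Matrix n n B) (hM : IsPosElem M) (hN : IsPosElem N) : IsPosElem (M + N) := by
  classical
  let := CStarAlgebra.spectralOrder B
  let := CStarAlgebra.spectralOrderedRing B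
  let _ : CStarAlgebra (CStarMatrix n n B) := inferInstance
  exact isPosElem_add_gen (X := CStarMatrix n n B) M N hM hN

open Matrix in
theorem isPosElem_rect {B : Type*} [CStarAlgebra B] {k n : Type*} [Fintype k] [Fintype n]
    [Nonempty n] (Y : Matrix k n B) : IsPosElem (Yᴴ * Y) := by
  classical
  have hsum : ∀ (s : Finset k) (F : k → Matrix n n B), (∀ i, IsPosElem (F i)) →
      IsPosElem (∑ i ∈ s, F i) := by
    intro s F hF
    induction s using Finset.induction_on with
    | empty => exact ⟨0, by simp⟩
    | insert a s ha ih => rw [Finset.sum_insert ha]; exact isPosElem_add_aux _ _ (hF a) ih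
  obtain ⟨z⟩ := ‹Nonempty n›
  have key : Yᴴ * Y = ∑ i, star (Matrix.of fun a b => if a = z then Y i b else 0 : Matrix n n B) *
      (Matrix.of fun a b => if a = z then Y i b else 0) := by
    ext p q
    simp only [Matrix.sum_apply, Matrix.mul_apply, Matrix.star_apply, Matrix.conjTranspose_apply,
      Matrix.of_apply]
    refine Finset.sum_congr rfl fun i _ => ?_
    rw [Finset.sum_eq_single z] <;> simp +contextual
  rw [key]
  exact hsum _ _ fun i => ⟨_, rfl⟩

open Matrix in
theorem isPosElem_compress {B : Type*} [CStarAlgebra B] {k n : Type*} [Fintype k] [Fintype n]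
    [Nonempty n] (P : Matrix k k B) (hP : IsPosElem P) (V : Matrix k n B) :
    IsPosElem (Vᴴ * P * V) := by
  obtain ⟨X, rfl⟩ := hP
  have : Vᴴ * (star X * X) * V = (X * V)ᴴ * (X * V) := by
    rw [Matrix.conjTranspose_mul, Matrix.star_eq_conjTranspose]; simp only [Matrix.mul_assoc]
  rw [this]; exact isPosElem_rect _

theorem isPosElem_star_entry {B : Type*} [CStarAlgebra B] {k : Type*} [Fintype k]
    (P : Matrix k k B) (hP : IsPosElem P) (i j : k) : star (P i j) = P j i := by
  obtain ⟨X, rfl⟩ := hP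
  have : star (star X * X) = star X * X := by simp
  conv_rhs => rw [← this]
  rfl

open Matrix in
theorem isNPosMap_mono {A B : Type*} [CStarAlgebra A] [CStarAlgebra B] {m n : ℕ} (hnm : n ≤ m)
    (hn : 0 < n) (φ : A → B) (h : IsNPosMap m φ) : IsNPosMap n φ := by
  rintro M ⟨X, rfl⟩
  have : Nonempty (Fin n) := ⟨⟨0, hn⟩⟩
  have : Nonempty (Fin m) := ⟨⟨0, hn.trans_le hnm⟩⟩
  let X' : Matrix (Fin n) (Fin m) A :=
    Matrix.of fun k i => if h : (i : ℕ) < n then X k ⟨i, h⟩ else 0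
  obtain ⟨Y, hY⟩ := h _ (isPosElem_rect X')
  have : (star X * X).map φ =
      (Y.submatrix id (Fin.castLE hnm))ᴴ * (Y.submatrix id (Fin.castLE hnm)) := by
    ext i j
    have := congrFun (congrFun hY (Fin.castLE hnm i)) (Fin.castLE hnm j)
    simpa [X', Matrix.mul_apply, Matrix.star_apply] using this
  rw [this]
  exact isPosElem_rect _

theorem isPosElem_schur {B : Type*} [CStarAlgebra B] (P : Matrix (Fin 3) (Fin 3) B)
    (hP : IsPosElem P) (h1 : P 2 2 = 1) :
    IsPosElem !![P 0 0 - P 0 2 * P 2 0, P 0 1 - P 0 2 * P 2 1;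
                 P 1 0 - P 1 2 * P 2 0, P 1 1 - P 1 2 * P 2 1] := by
  have hs := isPosElem_star_entry P hP
  have := isPosElem_compress P hP !![1, 0; 0, 1; - P 2 0, - P 2 1]
  convert this using 1
  ext i j
  fin_cases i <;> fin_cases j <;>
    simp [Matrix.mul_apply, Fin.sum_univ_succ, hs, h1, sub_eq_add_neg]

open ComplexOrder in
theorem isPosElem_of_pointwise {Ω : Type*} [TopologicalSpace Ω] [CompactSpace Ω]
    {n : Type*} [Fintype n] [DecidableEq n] (M : Matrix n n C(Ω, ℂ))
    (h : ∀ x, (M.map fun f => f x).PosSemidef) : IsPosElem M := by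
  let := CStarAlgebra.spectralOrder C(Ω, ℂ)
  let := CStarAlgebra.spectralOrderedRing C(Ω, ℂ)
  have hsa : IsSelfAdjoint (CStarMatrix.ofMatrix M) := by
    change star M = M
    ext i j x
    exact congrFun (congrFun (h x).1 i) j
  refine isPosElem_of_spectrum_gen (X := CStarMatrix n n C(Ω, ℂ)) M hsa fun r hneg => ?_
  have hu : IsUnit (algebraMap ℂ (Matrix n n C(Ω, ℂ)) (r : ℂ) - M) := by
    rw [Matrix.isUnit_iff_isUnit_det, ContinuousMap.isUnit_iff_forall_ne_zero]
    intro x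
    have e : (algebraMap ℂ (Matrix n n C(Ω, ℂ)) (r : ℂ) - M).det x =
        (-((M.map fun f => f x) + Matrix.diagonal fun _ => ((-r : ℝ) : ℂ))).det := by
      change ContinuousMap.evalAlgHom ℂ ℂ x _ = _
      rw [AlgHom.map_det]
      congr 1
      ext i j
      by_cases hij : i = j
      · subst hij; simp [Matrix.algebraMap_matrix_apply]; ring
      · simp [Matrix.algebraMap_matrix_apply, hij]
    rw [e, Matrix.det_neg]
    refine mul_ne_zero (by simp) (ne_of_gt ?_)
    refine Matrix.PosDef.det_pos ?_
    refine Matrix.PosDef.posSemidef_add (h x) (Matrix.PosDef.diagonal fun _ => ?_)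
    exact_mod_cast neg_pos.mpr hneg
  exact hu.map (CStarMatrix.ofMatrixRingEquiv (n := n) (A := C(Ω, ℂ)))

theorem psi_star_aux {A C : Type*} [CStarAlgebra A] [CStarAlgebra C] (ψ : A →ₗ[ℂ] C)
    (h : ∀ a : A, IsPosElem a → IsPosElem (ψ a)) (a : A) : ψ (star a) = star (ψ a) := by
  let := CStarAlgebra.spectralOrder A
  let := CStarAlgebra.spectralOrderedRing A
  let := CStarAlgebra.spectralOrder C
  let := CStarAlgebra.spectralOrderedRing C
  let f : A →ₚ[ℂ] C := PositiveLinearMap.mk₀ ψ fun x hx => by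
    have := h x (CStarAlgebra.nonneg_iff_eq_star_mul_self.mp hx)
    exact CStarAlgebra.nonneg_iff_eq_star_mul_self.mpr this
  exact map_star f a

open ComplexOrder in
theorem gram_pos {A : Type*} [CStarAlgebra A] {Ω : Type*} [TopologicalSpace Ω] [CompactSpace Ω]
    (ψ : A →ₗ[ℂ] C(Ω, ℂ)) (h : ∀ a : A, IsPosElem a → IsPosElem (ψ a))
    {n : Type*} [Fintype n] [DecidableEq n] (v : n → A) :
    IsPosElem (Matrix.of fun i j => ψ (star (v i) * v j)) := by
  refine isPosElem_of_pointwise _ fun x => ?_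
  refine Matrix.PosSemidef.of_dotProduct_mulVec_nonneg ?_ ?_
  · ext i j
    simp only [Matrix.conjTranspose_apply, Matrix.map_apply, Matrix.of_apply]
    have := psi_star_aux ψ h (star (v j) * v i)
    rw [star_mul, star_star] at this
    rw [this]; rfl
  · intro c
    obtain ⟨g, hg⟩ := h _ ⟨∑ i, c i • v i, rfl⟩
    have e : star c ⬝ᵥ (Matrix.map (Matrix.of fun i j => ψ (star (v i) * v j)) fun f => f x).mulVec c
        = (ψ (star (∑ i, c i • v i) * ∑ i, c i • v i)) x := by
      simp only [star_sum, star_smul, Finset.sum_mul, Finset.mul_sum, map_sum, dotProduct,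
        Matrix.mulVec, Matrix.map_apply, Matrix.of_apply, smul_mul_assoc, mul_smul_comm, map_smul,
        ContinuousMap.coe_sum, Finset.sum_apply, ContinuousMap.coe_smul, Pi.smul_apply,
        smul_eq_mul, Pi.star_apply]
      rw [Finset.sum_comm]
      refine Finset.sum_congr rfl fun i _ => Finset.sum_congr rfl fun j _ => ?_
      ring
    rw [e, hg]
    exact star_mul_self_nonneg (g x)

theorem superadd_aux {C B : Type*} [CStarAlgebra C] [CStarAlgebra B] (φ : C → B)
    (h3 : IsNPosMap 3 φ) (h0 : φ 0 = 0) (x y : C) (hx : IsPosElem x) (hy : IsPosElem y) :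
    IsPosElem (φ (x + y) - φ x - φ y) := by
  obtain ⟨p, rfl⟩ := hx
  obtain ⟨q, rfl⟩ := hy
  have h := h3 _ (isPosElem_rect !![p, p, 0; 0, q, q])
  obtain ⟨b, hb⟩ := isPosElem_compress _ h !![(-1 : B); 1; -1]
  refine ⟨b 0 0, ?_⟩
  have := congrFun (congrFun hb 0) 0
  simp [Matrix.mul_apply, Matrix.star_apply, Fin.sum_univ_succ, h0] at this
  rw [← this]
  abel

theorem kadison_aux {C B : Type*} [CStarAlgebra C] [CStarAlgebra B] (φ : C → B)
    (h2 : IsNPosMap 2 φ) (h1 : φ 1 = 1) (a : C) (ha : star a = a) :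
    IsPosElem (φ (a * a) - φ a * φ a) := by
  have h := h2 _ (isPosElem_rect !![a, 1])
  have hs := isPosElem_star_entry _ h 0 1
  obtain ⟨b, hb⟩ := isPosElem_compress _ h !![(1 : B); - φ a]
  refine ⟨b 0 0, ?_⟩
  have := congrFun (congrFun hb 0) 0
  simp [Matrix.mul_apply, ha] at hs
  simp [Matrix.mul_apply, Matrix.star_apply, Fin.sum_univ_succ, h1, ha, hs] at this
  rw [← this]
  abel

theorem isPosElem_map_star {C : Type*} [CommCStarAlgebra C] {n : Type*} [Fintype n]
    (K : Matrix n n C) (h : IsPosElem K) : IsPosElem K.transpose := by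
  obtain ⟨X, rfl⟩ := h
  refine ⟨X.map star, ?_⟩
  ext i j
  simp [Matrix.mul_apply, Matrix.star_apply, mul_comm]

theorem isPosElem_diag2 {B : Type*} [CStarAlgebra B] (x y : B) (hx : IsPosElem x)
    (hy : IsPosElem y) : IsPosElem !![x, 0; 0, y] := by
  obtain ⟨p, rfl⟩ := hx
  obtain ⟨q, rfl⟩ := hy
  refine ⟨!![p, 0; 0, q], ?_⟩
  ext i j
  fin_cases i <;> fin_cases j <;> simp [Matrix.mul_apply, Matrix.star_apply]

theorem final_aux {B : Type*} [CStarAlgebra B] (a b c d a' b' a'' b'' a2 b2 : B)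
    (h : IsPosElem !![a', c; d, b']) (sa : IsPosElem (a - a' - a''))
    (sb : IsPosElem (b - b' - b'')) (ka : IsPosElem (a'' - a2)) (kb : IsPosElem (b'' - b2)) :
    IsPosElem !![a - a2, c; d, b - b2] := by
  have hfin := isPosElem_add_aux _ _ h
    (isPosElem_add_aux _ _ (isPosElem_diag2 _ _ sa sb) (isPosElem_diag2 _ _ ka kb))
  convert hfin using 1
  ext i j
  fin_cases i <;> fin_cases j <;> simp <;> abel

/-- Theorem 4.1 (i), (ii): if `Φ : 𝒜 → ℬ` is unital positive with `Φ(0) = 0` and enjoys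
property `𝒟_m` for some `m ≥ 3`, then for self-adjoint `A, B` both the
variance-covariance matrix and the commutator uncertainty matrix are positive in `M₂(ℬ)`. -/
theorem variance_covariance_and_commutator_matrix_positive
    {𝒜 ℬ : Type*} [CStarAlgebra 𝒜] [CStarAlgebra ℬ]
    (Φ : 𝒜 → ℬ) (hunital : Φ 1 = 1)
    (hpos : ∀ a : 𝒜, IsPosElem a → IsPosElem (Φ a)) (h0 : Φ 0 = 0)
    (m : ℕ) (hm : 3 ≤ m) (hD : PropertyD.{v} m Φ)
    (A B : 𝒜) (hA : star A = A) (hB : star B = B) :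
    IsPosElem !![Φ (A * A) - Φ A * Φ A, Φ (A * B) - Φ A * Φ B;
                 Φ (B * A) - Φ B * Φ A, Φ (B * B) - Φ B * Φ B] ∧
    IsPosElem !![Φ (A * A) - Φ A * Φ A, Φ ((1 / 2 : ℂ) • (A * B - B * A));
                 Φ ((1 / 2 : ℂ) • (B * A - A * B)), Φ (B * B) - Φ B * Φ B] := by

  obtain ⟨Ω, _, _, _, ψ, φ, hψ1, hψ, hφ1, hφ, hΦ⟩ := hD
  have hφ0 : φ 0 = 0 := by have := hΦ 0; rw [map_zero, h0] at this; exact this.symm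
  have h3 : IsNPosMap 3 φ := isNPosMap_mono hm (by norm_num) φ hφ
  have h2 : IsNPosMap 2 φ := isNPosMap_mono (by omega) (by norm_num) φ hφ
  have hG := gram_pos ψ hψ ![A, B, 1]
  have hψA : star (ψ A) = ψ A := by rw [← psi_star_aux ψ hψ, hA]
  have hψB : star (ψ B) = ψ B := by rw [← psi_star_aux ψ hψ, hB]
  constructor
  · have h := isPosElem_schur _ (h3 _ hG) (by simp [hψ1, hφ1])
    simpa [hA, hB, hΦ] using h
  · have hK := isPosElem_schur _ hG (by simp [hψ1])
    simp [hA, hB] at hK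
    set K : Matrix (Fin 2) (Fin 2) C(Ω, ℂ) :=
      !![ψ (A * A) - ψ A * ψ A, ψ (A * B) - ψ A * ψ B;
         ψ (B * A) - ψ B * ψ A, ψ (B * B) - ψ B * ψ B] with hKdef
    let s : C(Ω, ℂ) := algebraMap ℂ C(Ω, ℂ) ((Real.sqrt (1 / 2) : ℝ) : ℂ)
    have hss : star s = s := by ext x; simp [s]
    have hsq : s * s = algebraMap ℂ C(Ω, ℂ) (1 / 2 : ℂ) := by
      rw [← map_mul, ← Complex.ofReal_mul, Real.mul_self_sqrt (by norm_num)]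
      norm_num
    have hD1 := isPosElem_compress K hK !![s, 0; 0, s]
    have hD2 := isPosElem_compress K.transpose (isPosElem_map_star K hK) !![s, 0; 0, -s]
    have hD := isPosElem_add_aux _ _ hD1 hD2
    have hE : IsPosElem !![ψ (A * A) - ψ A * ψ A, ψ ((1 / 2 : ℂ) • (A * B - B * A));
        ψ ((1 / 2 : ℂ) • (B * A - A * B)), ψ (B * B) - ψ B * ψ B] := by
      convert hD using 1
      have hsx : ∀ x, s x * s x = 1 / 2 := fun x => by
        have := congrArg (fun f : C(Ω, ℂ) => f x) hsq
        simpa using this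
      ext i j x
      have := hsx x
      fin_cases i <;> fin_cases j <;>
        simp [Matrix.mul_apply, hss, hKdef, -one_div] <;> grind
    have hEφ := h2 _ hE
    have hva : IsPosElem (ψ (A * A) - ψ A * ψ A) := by
      obtain ⟨b, hb⟩ := isPosElem_compress K hK !![(1 : C(Ω, ℂ)); 0]
      refine ⟨b 0 0, ?_⟩
      have := congrFun (congrFun hb 0) 0
      simpa [Matrix.mul_apply, Matrix.star_apply, Fin.sum_univ_succ, hKdef] using this
    have hvb : IsPosElem (ψ (B * B) - ψ B * ψ B) := by
      obtain ⟨b, hb⟩ := isPosElem_compress K hK !![(0 : C(Ω, ℂ)); 1]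
      refine ⟨b 0 0, ?_⟩
      have := congrFun (congrFun hb 0) 0
      simpa [Matrix.mul_apply, Matrix.star_apply, Fin.sum_univ_succ, hKdef] using this
    have sa := superadd_aux φ h3 hφ0 _ _ hva ⟨ψ A, by rw [hψA]⟩
    have sb := superadd_aux φ h3 hφ0 _ _ hvb ⟨ψ B, by rw [hψB]⟩
    have ka := kadison_aux φ h2 hφ1 _ hψA
    have kb := kadison_aux φ h2 hφ1 _ hψB
    rw [sub_add_cancel] at sa
    rw [sub_add_cancel] at sb
    simp only [hΦ]
    refine final_aux _ _ _ _ _ _ _ _ _ _ ?_ sa sb ka kb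
    convert hEφ using 1
    ext i j
    fin_cases i <;> fin_cases j <;> rfl
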